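/- Let a be a vertex of a finite simple graph X and let Z be the graph obtained from X by adjoining two new vertices b and c, each adjacent to a and to no other vertex. If the multiplicity of 0 as a root of the characteristic polynomial of the adjacency matrix of X∖a is at most the multiplicity of 0 as a root of the characteristic polynomial of the adjacency matrix of X, then b and c are strongly cospectral vertices of Z. -/

import Mathlib

open Matrix BigOperators

/-- A spectral decomposition of a real symmetric matrix `A`: the `θ r` are the distinct
eigenvalues and `E r` is the orthogonal projection onto the `θ r`-eigenspace. -/
structure IsSpectralDecomp {V : Type*} [Fintype V] [DecidableEq V] (A : Matrix V V ℝ)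
    {m : ℕ} (θ : Fin m → ℝ) (E : Fin m → Matrix V V ℝ) : Prop where
  theta_inj : Function.Injective θ
  symm : ∀ r, (E r)ᵀ = E r
  idem : ∀ r, E r * E r = E r
  mul_eq_zero : ∀ r s, r ≠ s → E r * E s = 0
  sum_eq_one : ∑ r, E r = 1
  eq_sum : A = ∑ r, θ r • E r
  ne_zero : ∀ r, E r ≠ 0

/-- For a real symmetric matrix, the algebraic and geometric multiplicities of `0` agree. -/
theorem Matrix.IsHermitian.rootMultiplicity_zero_charpoly {n : Type*} [Fintype n] [DecidableEq n]
    {A : Matrix n n ℝ} (hA : A.IsHermitian) :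
    A.charpoly.rootMultiplicity 0 = Module.finrank ℝ (LinearMap.ker A.mulVecLin) := by
  have hroot : A.charpoly.rootMultiplicity 0 = Fintype.card {i // hA.eigenvalues i = 0} := by
    rw [← Polynomial.count_roots, hA.roots_charpoly_eq_eigenvalues, Multiset.count_map,
      Fintype.card_subtype, ← Finset.filter_val, Finset.card_val]
    simp [eq_comm]
  have hrank := hA.rank_eq_card_non_zero_eigs
  have hnull := LinearMap.finrank_range_add_finrank_ker A.mulVecLin
  have hcompl := Fintype.card_subtype_compl (fun i => hA.eigenvalues i = 0)
  have hle := Fintype.card_subtype_le (fun i => hA.eigenvalues i = 0)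
  rw [Module.finrank_fintype_fun_eq_card] at hnull
  unfold Matrix.rank at hrank
  simp only [ne_eq] at hrank
  omega

/-- If `v a = 0`, deleting the index `a` from both `A` and `v` does not change the remaining
entries of `A *ᵥ v`. -/
theorem Matrix.submatrix_ne_mulVec_apply {n : Type*} [Fintype n] [DecidableEq n]
    (A : Matrix n n ℝ) {a : n} {v : n → ℝ} (hv : v a = 0) (i : {x : n // x ≠ a}) :
    (A.submatrix (fun i : {x : n // x ≠ a} => (i : n)) (fun i : {x : n // x ≠ a} => (i : n)) *ᵥ
      fun j => v j) i = (A *ᵥ v) i := by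
  simp only [Matrix.mulVec, dotProduct, Matrix.submatrix_apply]
  rw [Fintype.sum_eq_add_sum_subtype_ne _ a, hv, mul_zero, zero_add]

/-- If `A *ᵥ u` is a nonzero multiple of the basis vector at `a` and `u a = 0`, then deleting
the index `a` from the symmetric matrix `A` increases the nullity. -/
theorem Matrix.IsHermitian.finrank_ker_lt_finrank_ker_submatrix_ne {n : Type*} [Fintype n]
    [DecidableEq n] {A : Matrix n n ℝ} (hA : A.IsHermitian) {a : n} {u : n → ℝ} (hua : u a = 0)
    {s : ℝ} (hs : s ≠ 0) (hu : A *ᵥ u = Pi.single a s) :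
    Module.finrank ℝ (LinearMap.ker A.mulVecLin) <
      Module.finrank ℝ (LinearMap.ker (A.submatrix (fun i : {x : n // x ≠ a} => (i : n))
        (fun i : {x : n // x ≠ a} => (i : n))).mulVecLin) := by
  let ext : ({x : n // x ≠ a} → ℝ) →ₗ[ℝ] n → ℝ :=
    LinearMap.pi fun x => if h : x ≠ a then LinearMap.proj ⟨x, h⟩ else 0
  have ext_restrict (v : n → ℝ) (hv : v a = 0) : ext (fun j => v j) = v := by
    funext x
    by_cases h : x = a
    · simp [ext, h, hv]
    · simp [ext, h]
  have ker_apply (y : n → ℝ) (hy : A *ᵥ y = 0) : y a = 0 := by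
    have h : y ⬝ᵥ A *ᵥ u = 0 := by
      rw [Matrix.dotProduct_mulVec, ← Matrix.mulVec_transpose,
        ← Matrix.conjTranspose_eq_transpose_of_trivial, hA.eq, hy, zero_dotProduct]
    rw [hu, dotProduct_single] at h
    exact (mul_eq_zero.mp h).resolve_right hs
  refine (Submodule.finrank_lt_finrank_of_lt (SetLike.lt_iff_le_and_exists.mpr
    ⟨fun y hy => ?_, u, ?_, ?_⟩)).trans_le (Submodule.finrank_map_le ext _)
  · rw [LinearMap.mem_ker, Matrix.mulVecLin_apply] at hy
    refine ⟨fun j => y j, ?_, ext_restrict y (ker_apply y hy)⟩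
    rw [SetLike.mem_coe, LinearMap.mem_ker, Matrix.mulVecLin_apply]
    funext i
    rw [Matrix.submatrix_ne_mulVec_apply A (ker_apply y hy), hy]
    rfl
  · refine ⟨fun j => u j, ?_, ext_restrict u hua⟩
    rw [SetLike.mem_coe, LinearMap.mem_ker, Matrix.mulVecLin_apply]
    funext i
    rw [Matrix.submatrix_ne_mulVec_apply A hua, hu, Pi.single_eq_of_ne i.2]
    rfl
  · rw [LinearMap.mem_ker, Matrix.mulVecLin_apply, hu]
    simpa using hs

namespace IsSpectralDecomp

variable {V : Type*} [Fintype V] [DecidableEq V] {A : Matrix V V ℝ} {m : ℕ} {θ : Fin m → ℝ}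
  {E : Fin m → Matrix V V ℝ}

theorem idempotent_mul (h : IsSpectralDecomp A θ E) (r : Fin m) : E r * A = θ r • E r := by
  rw [h.eq_sum, Finset.mul_sum, Finset.sum_eq_single r]
  · rw [Matrix.mul_smul, h.idem]
  · intro s _ hs
    rw [Matrix.mul_smul, h.mul_eq_zero r s hs.symm, smul_zero]
  · simp

theorem mul_idempotent (h : IsSpectralDecomp A θ E) (r : Fin m) : A * E r = θ r • E r := by
  rw [h.eq_sum, Finset.sum_mul, Finset.sum_eq_single r]
  · rw [Matrix.smul_mul, h.idem]
  · intro s _ hs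
    rw [Matrix.smul_mul, h.mul_eq_zero s r hs, smul_zero]
  · simp

end IsSpectralDecomp

/-- Rabbit-ear construction: attach two new pendant vertices (`Sum.inr true` and
`Sum.inr false`) to the vertex `a` of `X`.  If the multiplicity of `0` as an eigenvalue
of `X ∖ a` is at most its multiplicity as an eigenvalue of `X`, then the two new vertices
are strongly cospectral in the new graph `Z`. -/
theorem rabbit_ear_stronglyCospectral {VX : Type*} [Fintype VX] [DecidableEq VX]
    (X : SimpleGraph VX) [DecidableRel X.Adj] (a : VX)
    (Z : SimpleGraph (VX ⊕ Bool)) [DecidableRel Z.Adj]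
    (hXX : ∀ x x' : VX, Z.Adj (Sum.inl x) (Sum.inl x') ↔ X.Adj x x')
    (hXB : ∀ (x : VX) (t : Bool), Z.Adj (Sum.inl x) (Sum.inr t) ↔ x = a)
    (hBB : ∀ s t : Bool, ¬Z.Adj (Sum.inr s) (Sum.inr t))
    (hmult : ((X.adjMatrix ℝ).submatrix (fun i : {x : VX // x ≠ a} => (i : VX))
          (fun i : {x : VX // x ≠ a} => (i : VX))).charpoly.rootMultiplicity 0 ≤
        (X.adjMatrix ℝ).charpoly.rootMultiplicity 0)
    {m : ℕ} (θ : Fin m → ℝ) (E : Fin m → Matrix (VX ⊕ Bool) (VX ⊕ Bool) ℝ)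
    (hdec : IsSpectralDecomp (Z.adjMatrix ℝ) θ E) :
    ∀ r, E r *ᵥ Pi.single (Sum.inr true) 1 = E r *ᵥ Pi.single (Sum.inr false) 1 ∨
      E r *ᵥ Pi.single (Sum.inr true) 1 = -(E r *ᵥ Pi.single (Sum.inr false) 1) := by
  have null_ears (w : VX ⊕ Bool → ℝ) (hw : Z.adjMatrix ℝ *ᵥ w = 0) :
      w (Sum.inr true) + w (Sum.inr false) = 0 := by
    by_contra hs
    have hwa : w (Sum.inl a) = 0 := by
      have h := congrFun hw (Sum.inr true)
      simpa [Matrix.mulVec, dotProduct, SimpleGraph.adjMatrix_apply, hBB, hXB,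
        Z.adj_comm (Sum.inr _) (Sum.inl _)] using h
    have hu : X.adjMatrix ℝ *ᵥ (fun x => w (Sum.inl x)) =
        Pi.single a (-(w (Sum.inr true) + w (Sum.inr false))) := by
      funext x
      have h := congrFun hw (Sum.inl x)
      simp only [Matrix.mulVec, dotProduct, SimpleGraph.adjMatrix_apply, hXX, hXB,
        Fintype.sum_sum_type, Fintype.sum_bool, Pi.zero_apply] at h
      simp only [Matrix.mulVec, dotProduct, SimpleGraph.adjMatrix_apply, Pi.single_apply]
      split_ifs at h ⊢ <;> linarith
    have hX : (X.adjMatrix ℝ).IsHermitian := by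
      rw [Matrix.IsHermitian, Matrix.conjTranspose_eq_transpose_of_trivial,
        SimpleGraph.transpose_adjMatrix]
    rw [hX.rootMultiplicity_zero_charpoly,
      (hX.submatrix fun i : {x : VX // x ≠ a} => (i : VX)).rootMultiplicity_zero_charpoly] at hmult
    exact hmult.not_gt (hX.finrank_ker_lt_finrank_ker_submatrix_ne hwa (neg_ne_zero.mpr hs) hu)
  intro r
  by_cases hr : θ r = 0
  · right
    funext z
    have h := null_ears ((E r).col z) (by
      rw [← Matrix.mulVec_single_one, Matrix.mulVec_mulVec, hdec.mul_idempotent, hr, zero_smul,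
        Matrix.zero_mulVec])
    have hsymm (t : Bool) : E r (Sum.inr t) z = E r z (Sum.inr t) :=
      congrFun (congrFun (hdec.symm r) z) (Sum.inr t)
    simp only [Matrix.col_apply, hsymm] at h
    simpa using eq_neg_of_add_eq_zero_left h
  · left
    have hadj : Z.adjMatrix ℝ *ᵥ Pi.single (Sum.inr true) 1 =
        Z.adjMatrix ℝ *ᵥ Pi.single (Sum.inr false) 1 := by
      funext z
      rcases z with x | t <;> simp [hXB, hBB]
    have h := congrArg (E r *ᵥ ·) hadj
    simp only [Matrix.mulVec_mulVec, hdec.idempotent_mul, Matrix.smul_mulVec] at h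
    exact smul_right_injective _ hr h
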